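/- Let M be a paracompact, locally compact Hausdorff topological space and X a finite-dimensional complex vector space. Then every closed two-sided ideal I of the topological algebra C(M, B(X)) is the vanishing ideal of a closed subset: there exists a closed set N ⊆ M such that I = {f ∈ C(M, B(X)) : f(t) = 0 for all t ∈ N}. -/

import Mathlib

/-- If some value of some element of `I` is nonzero at `t`, then `I` contains a scalar-valued
nonnegative function which is positive at `t`. -/
theorem exists_nonneg_scalar_mem_of_apply_ne_zero
    {M : Type*} [TopologicalSpace M]
    {X : Type*} [NormedAddCommGroup X] [NormedSpace ℂ X] [FiniteDimensional ℂ X]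
    (I : TwoSidedIdeal C(M, X →L[ℂ] X)) {f : C(M, X →L[ℂ] X)} (hf : f ∈ I) {t : M}
    (ht : f t ≠ 0) :
    ∃ ψ : C(M, ℝ), ∃ g ∈ I, (∀ s, g s = (ψ s : ℂ) • (1 : X →L[ℂ] X)) ∧ (∀ s, 0 ≤ ψ s) ∧
      0 < ψ t := by
  obtain ⟨v, hv⟩ : ∃ v, f t v ≠ 0 := by
    by_contra! h
    exact ht (ContinuousLinearMap.ext h)
  obtain ⟨ξ, -, hξ⟩ := exists_dual_vector ℂ (f t v) (norm_ne_zero_iff.mpr hv)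
  have hξ0 : ξ (f t v) ≠ 0 := by
    rw [hξ]
    simpa using hv
  let b := Module.finBasis ℂ X
  let φ : C(M, ℂ) := ⟨fun s => ξ (f s v), by fun_prop⟩
  let A : Fin (Module.finrank ℂ X) → C(M, X →L[ℂ] X) := fun i =>
    ContinuousMap.const M (ξ.smulRight (b i))
  let B : Fin (Module.finrank ℂ X) → C(M, X →L[ℂ] X) := fun i =>
    ContinuousMap.const M ((LinearMap.toContinuousLinearMap (b.coord i)).smulRight v)
  let D : C(M, X →L[ℂ] X) := ⟨fun s => (starRingEnd ℂ (φ s)) • (1 : X →L[ℂ] X), by fun_prop⟩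
  refine ⟨⟨fun s => ‖φ s‖ ^ 2, by fun_prop⟩, (∑ i, A i * f * B i) * D, ?_, ?_, ?_, ?_⟩
  · refine I.mul_mem_right _ _ (sum_mem fun i _ => ?_)
    exact I.mul_mem_right _ _ (I.mul_mem_left _ _ hf)
  · intro s
    have h : (∑ i, A i * f * B i) s = φ s • (1 : X →L[ℂ] X) := by
      ext x
      have hx : ∀ i, (A i * f * B i) s x = φ s • (b.repr x i • b i) := fun i => by
        change ξ (f s (b.coord i x • v)) • b i = _
        rw [map_smul, map_smul, smul_eq_mul, mul_comm, mul_smul]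
        rfl
      rw [ContinuousMap.sum_apply, sum_apply, Finset.sum_congr rfl fun i _ => hx i,
        ← Finset.smul_sum, b.sum_repr]
      rfl
    rw [ContinuousMap.mul_apply, h]
    ext x
    simp [D, smul_smul, Complex.conj_mul']
  · intro s
    simp only [ContinuousMap.coe_mk]
    positivity
  · have : φ t ≠ 0 := hξ0
    simp only [ContinuousMap.coe_mk]
    positivity

/-- On a compact set where the elements of `I` have no common zero, some nonnegative
scalar-valued element of `I` is positive. -/
theorem exists_nonneg_scalar_mem_pos_on_compact
    {M : Type*} [TopologicalSpace M]
    {X : Type*} [NormedAddCommGroup X] [NormedSpace ℂ X] [FiniteDimensional ℂ X]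
    (I : TwoSidedIdeal C(M, X →L[ℂ] X)) {L : Set M} (hL : IsCompact L)
    (h : ∀ t ∈ L, ∃ f ∈ I, f t ≠ 0) :
    ∃ ψ : C(M, ℝ), ∃ g ∈ I, (∀ s, g s = (ψ s : ℂ) • (1 : X →L[ℂ] X)) ∧ (∀ s, 0 ≤ ψ s) ∧
      ∀ t ∈ L, 0 < ψ t := by
  refine hL.induction_on (p := fun L => ∃ ψ : C(M, ℝ), ∃ g ∈ I,
    (∀ s, g s = (ψ s : ℂ) • (1 : X →L[ℂ] X)) ∧ (∀ s, 0 ≤ ψ s) ∧ ∀ t ∈ L, 0 < ψ t)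
    ⟨0, 0, I.zero_mem, by simp, by simp, by simp⟩ ?_ ?_ ?_
  · rintro s t hst ⟨ψ, g, hg, hgψ, hψ, hpos⟩
    exact ⟨ψ, g, hg, hgψ, hψ, fun x hx => hpos x (hst hx)⟩
  · rintro s t ⟨ψ₁, g₁, hg₁, hgψ₁, hψ₁, hpos₁⟩ ⟨ψ₂, g₂, hg₂, hgψ₂, hψ₂, hpos₂⟩
    refine ⟨ψ₁ + ψ₂, g₁ + g₂, I.add_mem hg₁ hg₂, fun x => ?_,
      fun x => add_nonneg (hψ₁ x) (hψ₂ x), ?_⟩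
    · simp [hgψ₁, hgψ₂, add_smul]
    · rintro x (hx | hx)
      · exact add_pos_of_pos_of_nonneg (hpos₁ x hx) (hψ₂ x)
      · exact add_pos_of_nonneg_of_pos (hψ₁ x) (hpos₂ x hx)
  · intro x hx
    obtain ⟨f, hf, hfx⟩ := h x hx
    obtain ⟨ψ, g, hg, hgψ, hψ, hpos⟩ := exists_nonneg_scalar_mem_of_apply_ne_zero I hf hfx
    exact ⟨{y | 0 < ψ y}, mem_nhdsWithin_of_mem_nhds
      ((isOpen_lt continuous_const ψ.continuous).mem_nhds hpos), ψ, g, hg, hgψ, hψ, fun _ => id⟩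

/-- A continuous function vanishing at all common zeros of the ideal `I` is a limit of elements
of `I`, uniformly on compact sets. -/
theorem mem_closure_of_forall_common_zero
    {M : Type*} [TopologicalSpace M]
    {X : Type*} [NormedAddCommGroup X] [NormedSpace ℂ X] [FiniteDimensional ℂ X]
    (I : TwoSidedIdeal C(M, X →L[ℂ] X)) {f : C(M, X →L[ℂ] X)}
    (hf : ∀ t, (∀ g ∈ I, g t = 0) → f t = 0) :
    f ∈ closure (I : Set C(M, X →L[ℂ] X)) := by
  rw [mem_closure_iff_nhds_basis
    (nhds_basis_uniformity Metric.uniformity_basis_dist.compactConvergenceUniformity)]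
  rintro ⟨K, ε⟩ ⟨hK, hε⟩
  simp only at hK hε
  have hL : IsCompact (K ∩ {t | ε ≤ ‖f t‖}) :=
    hK.inter_right (isClosed_le continuous_const (by fun_prop))
  obtain ⟨ψ, g, hg, hgψ, hψ, hpos⟩ := exists_nonneg_scalar_mem_pos_on_compact I hL (by
    rintro t ⟨-, ht⟩
    by_contra! h
    have : ε ≤ ‖f t‖ := ht
    rw [hf t h, norm_zero] at this
    exact this.not_gt hε)
  obtain ⟨c, hc, hcψ⟩ : ∃ c > 0, ∀ t ∈ K ∩ {t | ε ≤ ‖f t‖}, c ≤ ψ t := by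
    rcases (K ∩ {t | ε ≤ ‖f t‖}).eq_empty_or_nonempty with h | h
    · exact ⟨1, one_pos, by simp [h]⟩
    · obtain ⟨t, ht, hmin⟩ := hL.exists_isMinOn h ψ.continuous.continuousOn
      exact ⟨ψ t, hpos t ht, fun s hs => hmin hs⟩
  obtain ⟨C, hC⟩ := hK.exists_bound_of_continuousOn f.continuous.continuousOn
  obtain ⟨δ, hδ, hδC⟩ : ∃ δ > 0, C * δ < ε * c := by
    refine ⟨ε * c / (|C| + 1), by positivity, ?_⟩
    rw [mul_div_assoc', div_lt_iff₀ (by positivity), mul_comm]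
    gcongr
    exact (le_abs_self C).trans_lt (lt_add_one _)
  have hden : ∀ t, 0 < ψ t + δ := fun t => add_pos_of_nonneg_of_pos (hψ t) hδ
  let ρ : C(M, ℝ) := ⟨fun t => (ψ t + δ)⁻¹, by
    exact (ψ.continuous.add continuous_const).inv₀ fun t => (hden t).ne'⟩
  let F : C(M, X →L[ℂ] X) := ⟨fun t => (ρ t : ℂ) • f t, by fun_prop⟩
  refine ⟨F * g, I.mul_mem_left _ _ hg, fun t ht => ?_⟩
  have hdiff : f t - (F * g) t = ((δ / (ψ t + δ) : ℝ) : ℂ) • f t := by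
    have h1 : ((δ / (ψ t + δ) : ℝ) : ℂ) = 1 - (ψ t : ℂ) * (ρ t : ℂ) := by
      have := (hden t).ne'
      rw [← Complex.ofReal_mul, ← Complex.ofReal_one, ← Complex.ofReal_sub]
      congr 1
      simp only [ρ, ContinuousMap.coe_mk]
      field_simp
      ring
    rw [h1, sub_smul, one_smul, ContinuousMap.mul_apply, hgψ, mul_smul_comm, mul_one, mul_smul]
    rfl
  change dist ((F * g) t) (f t) < ε
  rw [dist_comm, dist_eq_norm, hdiff, norm_smul, Complex.norm_real, Real.norm_eq_abs,
    abs_of_pos (div_pos hδ (hden t)), div_mul_eq_mul_div, div_lt_iff₀ (hden t)]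
  by_cases h : ε ≤ ‖f t‖
  · calc δ * ‖f t‖ ≤ δ * C := by gcongr; exact hC t ht
      _ = C * δ := mul_comm _ _
      _ < ε * c := hδC
      _ ≤ ε * (ψ t + δ) := by
        gcongr
        linarith [hcψ t ⟨ht, h⟩]
  · calc δ * ‖f t‖ < δ * ε := by gcongr; exact not_le.mp h
      _ ≤ ε * (ψ t + δ) := by nlinarith [hψ t]

/-- Let `M` be a paracompact, locally compact Hausdorff space and `X` a finite-dimensional
complex vector space, with `B(X)` the algebra of linear endomorphisms of `X` (realized as
continuous linear endomorphisms of a finite-dimensional normed space, which are all linear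
endomorphisms). Every closed two-sided ideal `I` of `C(M, B(X))` (with the compact-open
topology) is the vanishing ideal of a closed subset `N ⊆ M`. -/
theorem closed_ideal_eq_vanishing_ideal
    (M : Type*) [TopologicalSpace M] [LocallyCompactSpace M] [ParacompactSpace M] [T2Space M]
    (X : Type*) [NormedAddCommGroup X] [NormedSpace ℂ X] [FiniteDimensional ℂ X]
    (I : TwoSidedIdeal C(M, X →L[ℂ] X)) (hI : IsClosed (I : Set C(M, X →L[ℂ] X))) :
    ∃ N : Set M, IsClosed N ∧ ∀ f : C(M, X →L[ℂ] X), f ∈ I ↔ ∀ t ∈ N, f t = 0 := by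
  refine ⟨⋂ g ∈ I, {t | g t = 0}, ?_, fun f => ⟨fun hf t ht => ?_, fun hf => ?_⟩⟩
  · exact isClosed_biInter fun g _ => isClosed_eq g.continuous continuous_const
  · exact Set.mem_iInter₂.mp ht f hf
  · have hfI := mem_closure_of_forall_common_zero I
      fun t ht => hf t (Set.mem_iInter₂.mpr ht)
    rwa [hI.closure_eq] at hfI
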